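/- arXiv:2509.02934 — 2 statements merged into one kernel-verified Lean document; each statement's English description precedes it below -/
import Mathlib

section
/- Let (E, ρ) be a metric space and let f : ℚ ∩ [0, ∞) → E be a function such that for every t ≥ 0 the right-sided limit lim_{q → t⁺, q ∈ ℚ} f(q) exists, and for every t > 0 the left-sided limit lim_{q → t⁻, q ∈ ℚ} f(q) exists. Define g : [0, ∞) → E by g(t) := lim_{q → t⁺, q ∈ ℚ} f(q). Then g is càdlàg: g is right-continuous at every t ≥ 0, and for every t > 0 the limit lim_{s → t⁻} g(s) exists and equals lim_{q → t⁻, q ∈ ℚ} f(q). -/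
open Filter

/-- Rationals accumulate from the right at every real number. -/
theorem comap_ratCast_nhdsGT_neBot (s : ℝ) :
    (comap (fun q : ℚ => (q : ℝ)) (nhdsWithin s (Set.Ioi s))).NeBot := by
  refine comap_neBot_iff.2 fun V hV => ?_
  obtain ⟨u, hu, hsub⟩ := mem_nhdsGT_iff_exists_Ioo_subset.1 hV
  obtain ⟨q, hsq, hqu⟩ := exists_rat_btwn (Set.mem_Ioi.1 hu)
  exact ⟨q, hsub ⟨hsq, hqu⟩⟩

/-- If `f` on the rationals tends to `l` at `t` within an open set `U`, then so does any function
which is the right rational limit of `f` at points of `U` near `t`. -/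
theorem tendsto_nhdsWithin_of_right_rat_limit {E : Type*} [TopologicalSpace E] [RegularSpace E]
    {f : ℚ → E} {g : ℝ → E} {U : Set ℝ} {t : ℝ} {l : E} (hU : IsOpen U)
    (hg : ∀ᶠ s in nhdsWithin t U, Tendsto f
      (comap (fun q : ℚ => (q : ℝ)) (nhdsWithin s (Set.Ioi s))) (nhds (g s)))
    (hl : Tendsto f (comap (fun q : ℚ => (q : ℝ)) (nhdsWithin t U)) (nhds l)) :
    Tendsto g (nhdsWithin t U) (nhds l) := by
  refine (closed_nhds_basis l).tendsto_right_iff.2 fun C ⟨hC, hC_closed⟩ => ?_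
  obtain ⟨V, hV, hVC⟩ := mem_comap.1 (hl hC)
  filter_upwards [hg, eventually_eventually_nhdsWithin.2 hV, self_mem_nhdsWithin]
    with s hs hVs hsU
  rw [hU.nhdsWithin_eq hsU] at hVs
  have := comap_ratCast_nhdsGT_neBot s
  exact hC_closed.mem_of_tendsto hs
    (mem_of_superset (preimage_mem_comap (mem_nhdsWithin_of_mem_nhds hVs)) hVC)

/-- if `f` on the rationals has right limits at every `t ≥ 0` and left limits at
every `t > 0`, and `g t` is defined as the right rational limit of `f` at `t`, then `g` is
càdlàg: right-continuous at each `t ≥ 0`, and at each `t > 0` the left limit of `g` exists and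
coincides with the left rational limit of `f`. -/
theorem right_limit_process_cadlag {E : Type*} [MetricSpace E] (f : ℚ → E) (g : ℝ → E)
    (hg : ∀ t : ℝ, 0 ≤ t → Tendsto f
      (comap (fun q : ℚ => (q : ℝ)) (nhdsWithin t (Set.Ioi t))) (nhds (g t)))
    (hleft : ∀ t : ℝ, 0 < t → ∃ l : E, Tendsto f
      (comap (fun q : ℚ => (q : ℝ)) (nhdsWithin t (Set.Iio t))) (nhds l)) :
    (∀ t : ℝ, 0 ≤ t → Tendsto g (nhdsWithin t (Set.Ici t)) (nhds (g t))) ∧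
    (∀ t : ℝ, 0 < t → ∃ l : E,
      Tendsto f (comap (fun q : ℚ => (q : ℝ)) (nhdsWithin t (Set.Iio t))) (nhds l) ∧
      Tendsto g (nhdsWithin t (Set.Iio t)) (nhds l)) := by
  refine ⟨fun t ht => ?_, fun t ht => ?_⟩
  · have hright : Tendsto g (nhdsWithin t (Set.Ioi t)) (nhds (g t)) :=
      tendsto_nhdsWithin_of_right_rat_limit isOpen_Ioi
        (eventually_mem_nhdsWithin.mono fun s hs => hg s (ht.trans (Set.mem_Ioi.1 hs).le)) (hg t ht)
    exact continuousWithinAt_Ioi_iff_Ici.1 hright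
  · obtain ⟨l, hl⟩ := hleft t ht
    refine ⟨l, hl, tendsto_nhdsWithin_of_right_rat_limit isOpen_Iio ?_ hl⟩
    filter_upwards [mem_nhdsWithin_of_mem_nhds (Ioi_mem_nhds ht)] with s hs
    exact hg s (Set.mem_Ioi.1 hs).le
end

section
/- Let (E, ρ) be a metric space with its Borel σ-algebra, (Q_t)_{t≥0} a family of Markov kernels on E such that Q_t f is bounded and continuous whenever f : E → ℝ is bounded and continuous. Let (Ω, F_∞, P) be a probability space with filtration (F_t)_{t≥0}, and let (B_t)_{t≥0} be an E-valued process adapted to (F_t) satisfying the Markov property: for every bounded measurable f and all r, t ≥ 0, the conditional expectation of f(B_{t+r}) given F_r equals (Q_t f)(B_r) almost surely, where Q_t f(x) = ∫_E f(y) Q_t(x, dy). Let (B̃_t)_{t≥0} be a modification of (B_t) (P(B̃_t = B_t) = 1 for every t) whose sample paths t ↦ B̃_t(ω) are all right-continuous. Let N be the class of F_∞-measurable P-null sets and set F̃_s := σ((⋂_{r>s} F_r) ∪ N), and assume B̃_s is F̃_s-measurable for every s. Then for every bounded continuous f : E → ℝ and all s, t ≥ 0, the conditional expectation of f(B̃_{t+s})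 given F̃_s equals (Q_t f)(B̃_s) almost surely. -/
open MeasureTheory ProbabilityTheory Filter

/-- An integrable function whose integral vanishes on a π-system and on the whole space has
vanishing integral on every set of the generated σ-algebra. -/
theorem setIntegral_eq_zero_of_isPiSystem {Ω : Type*} [mF : MeasurableSpace Ω] {P : Measure Ω}
    {h : Ω → ℝ} (hint : Integrable h P) {S : Set (Set Ω)} (hS : IsPiSystem S)
    (hle : MeasurableSpace.generateFrom S ≤ mF) (hzero : ∀ A ∈ S, ∫ ω in A, h ω ∂P = 0)
    (huniv : ∫ ω, h ω ∂P = 0) {A : Set Ω}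
    (hA : MeasurableSet[MeasurableSpace.generateFrom S] A) :
    ∫ ω in A, h ω ∂P = 0 := by
  induction A, hA using MeasurableSpace.induction_on_inter rfl hS with
  | empty => simp
  | basic A hA => exact hzero A hA
  | compl A hA ih =>
    have := integral_add_compl (hle A hA) hint
    linarith
  | iUnion f hd hm ih =>
    rw [integral_iUnion (fun i => hle _ (hm i)) hd hint.integrableOn]
    simp [ih]

theorem isPiSystem_forall_gt_union_null {Ω : Type*} [mF : MeasurableSpace Ω] (P : Measure Ω)
    (ℱ : Filtration ℝ mF) (s : ℝ) :
    IsPiSystem ({A | ∀ r : ℝ, s < r → MeasurableSet[ℱ r] A} ∪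
      {A | MeasurableSet[mF] A ∧ P A = 0}) := by
  have hmeas : ∀ A : Set Ω, (∀ r : ℝ, s < r → MeasurableSet[ℱ r] A) → MeasurableSet A :=
    fun A hA => ℱ.le (s + 1) A (hA _ (by linarith))
  rintro A (hA | ⟨hA, hA0⟩) A' (hA' | ⟨hA', hA'0⟩) -
  · exact Or.inl fun r hr => (hA r hr).inter (hA' r hr)
  · exact Or.inr ⟨(hmeas A hA).inter hA', measure_mono_null Set.inter_subset_right hA'0⟩
  · exact Or.inr ⟨hA.inter (hmeas A' hA'), measure_mono_null Set.inter_subset_left hA0⟩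
  · exact Or.inr ⟨hA.inter hA', measure_mono_null Set.inter_subset_left hA0⟩

theorem generateFrom_forall_gt_union_null_le {Ω : Type*} [mF : MeasurableSpace Ω] (P : Measure Ω)
    (ℱ : Filtration ℝ mF) (s : ℝ) :
    MeasurableSpace.generateFrom ({A | ∀ r : ℝ, s < r → MeasurableSet[ℱ r] A} ∪
      {A | MeasurableSet[mF] A ∧ P A = 0}) ≤ mF := by
  refine MeasurableSpace.generateFrom_le ?_
  rintro A (hA | ⟨hA, -⟩)
  · exact ℱ.le (s + 1) A (hA _ (by linarith))
  · exact hA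

/-- The agreement set of `X` and `Y` need not be measurable when `E` is not separable, so only its
outer measure is assumed to be one. -/
theorem ae_eq_comp_of_measure_eq_one {Ω E : Type*} [MeasurableSpace Ω] [MeasurableSpace E]
    {P : Measure Ω} [IsProbabilityMeasure P] {X Y : Ω → E} (hX : Measurable X) (hY : Measurable Y)
    (h : P {ω | X ω = Y ω} = 1) {f : E → ℝ} (hf : Measurable f) :
    (fun ω => f (X ω)) =ᵐ[P] fun ω => f (Y ω) := by
  have hm : MeasurableSet {ω | f (X ω) = f (Y ω)} :=
    measurableSet_eq_fun (hf.comp hX) (hf.comp hY)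
  have h1 : P {ω | f (X ω) = f (Y ω)} = 1 := by
    refine le_antisymm prob_le_one (h ▸ measure_mono fun ω hω => ?_)
    exact congrArg f hω
  exact (mem_ae_iff_prob_eq_one hm).2 h1

/-- a right-continuous modification `B̃` of a Markov process `B` with a Feller-type
semigroup `Q` is a Markov process with respect to the augmented right-continuous filtration
`F̃_s = σ((⋂_{r>s} F_r) ∪ N)`. -/
theorem modification_markov_augmented {Ω E : Type*} [mF : MeasurableSpace Ω]
    [MetricSpace E] [MeasurableSpace E] [BorelSpace E]
    (P : Measure Ω) [IsProbabilityMeasure P]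
    (ℱ : Filtration ℝ mF)
    (Q : ℝ → Kernel E E) [∀ t, IsMarkovKernel (Q t)]
    (hFeller : ∀ t : ℝ, 0 ≤ t → ∀ f : E → ℝ, Continuous f → (∃ C, ∀ x, |f x| ≤ C) →
      Continuous (fun x => ∫ y, f y ∂(Q t x)) ∧ ∃ C, ∀ x, |∫ y, f y ∂(Q t x)| ≤ C)
    (B : ℝ → Ω → E) (hadapted : ∀ t : ℝ, Measurable[ℱ t] (B t))
    (hMarkov : ∀ f : E → ℝ, Measurable f → (∃ C, ∀ x, |f x| ≤ C) →
      ∀ r t : ℝ, 0 ≤ r → 0 ≤ t →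
        P[fun ω => f (B (t + r) ω)|ℱ r] =ᵐ[P] fun ω => ∫ y, f y ∂(Q t (B r ω)))
    (Btilde : ℝ → Ω → E)
    (hmod : ∀ t : ℝ, 0 ≤ t → P {ω | Btilde t ω = B t ω} = 1)
    (hrc : ∀ ω : Ω, ∀ t : ℝ, 0 ≤ t →
      Tendsto (fun r => Btilde r ω) (nhdsWithin t (Set.Ici t)) (nhds (Btilde t ω)))
    (hBtmeas : ∀ s : ℝ, 0 ≤ s → Measurable[MeasurableSpace.generateFrom
      ({A | ∀ r : ℝ, s < r → MeasurableSet[ℱ r] A} ∪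
        {A | MeasurableSet[mF] A ∧ P A = 0})] (Btilde s)) :
    ∀ f : E → ℝ, Continuous f → (∃ C, ∀ x, |f x| ≤ C) → ∀ s t : ℝ, 0 ≤ s → 0 ≤ t →
      P[fun ω => f (Btilde (t + s) ω)|MeasurableSpace.generateFrom
          ({A | ∀ r : ℝ, s < r → MeasurableSet[ℱ r] A} ∪
            {A | MeasurableSet[mF] A ∧ P A = 0})] =ᵐ[P]
        fun ω => ∫ y, f y ∂(Q t (Btilde s ω)) := by
  intro f hf hfb s t hs ht
  obtain ⟨hg, hgb⟩ := hFeller t ht f hf hfb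
  set g : E → ℝ := fun x => ∫ y, f y ∂(Q t x) with hg_def
  have hle := generateFrom_forall_gt_union_null_le P ℱ
  have hBm : ∀ r, Measurable (B r) := fun r => (hadapted r).mono (ℱ.le r) le_rfl
  have hBtm : ∀ r, 0 ≤ r → Measurable (Btilde r) := fun r hr =>
    (hBtmeas r hr).mono (hle r) le_rfl
  have hint : ∀ k : E → ℝ, Continuous k → (∃ C, ∀ x, |k x| ≤ C) → ∀ r, 0 ≤ r →
      Integrable (fun ω => k (Btilde r ω)) P := by
    rintro k hk ⟨C, hC⟩ r hr
    exact Integrable.of_bound (hk.measurable.comp (hBtm r hr)).aestronglyMeasurable C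
      (Eventually.of_forall fun ω => hC _)
  have hseq : Tendsto (fun n : ℕ => s + 1 / ((n : ℝ) + 1)) atTop (nhds s) := by
    simpa using tendsto_const_nhds.add (tendsto_one_div_add_atTop_nhds_zero_nat (𝕜 := ℝ))
  have hpos : ∀ n : ℕ, (0 : ℝ) < 1 / ((n : ℝ) + 1) := fun n => by positivity
  have hlim : ∀ k : E → ℝ, Continuous k → (∃ C, ∀ x, |k x| ≤ C) → ∀ u, 0 ≤ u → ∀ A : Set Ω,
      Tendsto (fun n : ℕ => ∫ ω in A, k (Btilde (u + (s + 1 / ((n : ℝ) + 1))) ω) ∂P) atTop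
        (nhds (∫ ω in A, k (Btilde (u + s) ω) ∂P)) := by
    rintro k hk ⟨C, hC⟩ u hu A
    refine tendsto_integral_of_dominated_convergence (fun _ => C) (fun n => ?_)
      (integrable_const C) (fun n => Eventually.of_forall fun ω => hC _)
      (Eventually.of_forall fun ω => ?_)
    · have := (hpos n).le
      exact (hk.measurable.comp (hBtm _ (by linarith))).aestronglyMeasurable
    · refine (hk.tendsto _).comp ((hrc ω (u + s) (by linarith)).comp ?_)
      refine tendsto_nhdsWithin_iff.2 ⟨tendsto_const_nhds.add hseq,
        Eventually.of_forall fun n => ?_⟩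
      have := (hpos n).le
      simp only [Set.mem_Ici]
      linarith
  have hstep : ∀ A : Set Ω, (∀ r : ℝ, s < r → MeasurableSet[ℱ r] A) → ∀ r, s < r →
      ∫ ω in A, f (Btilde (t + r) ω) ∂P = ∫ ω in A, g (Btilde r ω) ∂P := by
    intro A hA r hr
    have hr0 : 0 ≤ r := hs.trans hr.le
    have hf_ae := ae_eq_comp_of_measure_eq_one (hBtm _ (add_nonneg ht hr0)) (hBm _)
      (hmod _ (add_nonneg ht hr0)) hf.measurable
    have hg_ae := ae_eq_comp_of_measure_eq_one (hBtm r hr0) (hBm r) (hmod r hr0) hg.measurable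
    rw [integral_congr_ae (ae_restrict_of_ae hf_ae), integral_congr_ae (ae_restrict_of_ae hg_ae),
      ← setIntegral_condExp (ℱ.le r) ((hint f hf hfb _ (add_nonneg ht hr0)).congr hf_ae)
        (hA r hr)]
    exact integral_congr_ae (ae_restrict_of_ae (hMarkov f hf.measurable hfb r t hr0 ht))
  have hgerm : ∀ A : Set Ω, (∀ r : ℝ, s < r → MeasurableSet[ℱ r] A) →
      ∫ ω in A, f (Btilde (t + s) ω) ∂P = ∫ ω in A, g (Btilde s ω) ∂P := by
    intro A hA
    have hlim_g := hlim g hg hgb 0 le_rfl A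
    simp only [zero_add] at hlim_g
    refine tendsto_nhds_unique (hlim f hf hfb t ht A) (hlim_g.congr fun n => ?_)
    exact (hstep A hA _ (by linarith [hpos n])).symm
  have hfi := hint f hf hfb (t + s) (add_nonneg ht hs)
  have hgi := hint g hg hgb s hs
  symm
  refine ae_eq_condExp_of_forall_setIntegral_eq (hle s) hfi (fun _ _ _ => hgi.integrableOn)
    (fun A hA _ => ?_)
    (hg.measurable.comp (hBtmeas s hs)).stronglyMeasurable.aestronglyMeasurable
  have hzero := setIntegral_eq_zero_of_isPiSystem (hgi.sub hfi)
    (isPiSystem_forall_gt_union_null P ℱ s) (hle s) ?_ ?_ hA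
  · simp only [Pi.sub_apply] at hzero
    rw [integral_sub hgi.integrableOn hfi.integrableOn] at hzero
    exact sub_eq_zero.1 hzero
  · rintro A (hA | ⟨-, hA0⟩)
    · simp only [Pi.sub_apply]
      rw [integral_sub hgi.integrableOn hfi.integrableOn, hgerm A hA, sub_self]
    · exact setIntegral_measure_zero _ hA0
  · have huniv := hgerm Set.univ fun _ _ => MeasurableSet.univ
    simp only [Measure.restrict_univ] at huniv
    simp only [Pi.sub_apply]
    rw [integral_sub hgi hfi, huniv, sub_self]
end
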